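/- Let 0<β<∞, let u be holomorphic on 𝔻 and φ a holomorphic self-map of 𝔻. Then uC_φ maps the Bloch space B = B^1 boundedly into Z_β if and only if sup_{z∈𝔻} (1-|z|²)^β |2u'(z)φ'(z) + u(z)φ''(z)| / (1-|φ(z)|²) < ∞, sup_{z∈𝔻} (1-|z|²)^β |u(z)| |φ'(z)|² / (1-|φ(z)|²)² < ∞, and sup_{z∈𝔻} (1-|z|²)^β |u''(z)| log(e/(1-|φ(z)|²)) < ∞. -/

import Mathlib

open Complex Filter Set

noncomputable section

/-- The open unit disk in `ℂ`. -/
def unitDisk : Set ℂ := Metric.ball 0 1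

/-- The weighted sup-norm `‖g‖_{ν_γ} = sup_{z ∈ 𝔻} (1-|z|²)^γ |g(z)|`. -/
def wnorm (γ : ℝ) (g : ℂ → ℂ) : ℝ :=
  sSup ((fun z => (1 - ‖z‖ ^ 2) ^ γ * ‖g z‖) '' unitDisk)

/-- Membership in the weighted Banach space `H^∞_{ν_β}`. -/
def MemWeighted (β : ℝ) (g : ℂ → ℂ) : Prop :=
  DifferentiableOn ℂ g unitDisk ∧
    BddAbove ((fun z => (1 - ‖z‖ ^ 2) ^ β * ‖g z‖) '' unitDisk)

/-- Membership in the Bloch type space `B^α`. -/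
def MemBloch (α : ℝ) (f : ℂ → ℂ) : Prop :=
  DifferentiableOn ℂ f unitDisk ∧
    BddAbove ((fun z => (1 - ‖z‖ ^ 2) ^ α * ‖deriv f z‖) '' unitDisk)

/-- The Bloch type norm `‖f‖_{B^α} = |f(0)| + sup_{z∈𝔻}(1-|z|²)^α |f'(z)|`. -/
def blochNorm (α : ℝ) (f : ℂ → ℂ) : ℝ :=
  ‖f 0‖ + wnorm α (deriv f)

/-- Membership in the Zygmund type space `Z_β`. -/
def MemZygmund (β : ℝ) (f : ℂ → ℂ) : Prop :=
  DifferentiableOn ℂ f unitDisk ∧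
    BddAbove ((fun z => (1 - ‖z‖ ^ 2) ^ β * ‖deriv (deriv f) z‖) '' unitDisk)

/-- The Zygmund type norm `‖f‖_{Z_β} = |f(0)| + |f'(0)| + sup_{z∈𝔻}(1-|z|²)^β |f''(z)|`. -/
def zygNorm (β : ℝ) (f : ℂ → ℂ) : ℝ :=
  ‖f 0‖ + ‖deriv f 0‖ + wnorm β (deriv (deriv f))

/-- The weighted composition operator `uC_φ f = u · (f ∘ φ)`. -/
def wcomp (u φ f : ℂ → ℂ) : ℂ → ℂ := fun z => u z * f (φ z)

/-- `uC_φ` maps `B^α` boundedly into `Z_β`. -/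
def BoundedBlochToZygmund (α β : ℝ) (u φ : ℂ → ℂ) : Prop :=
  (∀ f, MemBloch α f → MemZygmund β (wcomp u φ f)) ∧
    ∃ C > 0, ∀ f, MemBloch α f → zygNorm β (wcomp u φ f) ≤ C * blochNorm α f

/-- `uC_φ` maps `B^α` boundedly into `H^∞_{ν_β}`. -/
def BoundedBlochToWeighted (α β : ℝ) (u φ : ℂ → ℂ) : Prop :=
  (∀ f, MemBloch α f → MemWeighted β (wcomp u φ f)) ∧
    ∃ C > 0, ∀ f, MemBloch α f → wnorm β (wcomp u φ f) ≤ C * blochNorm α f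

/-- `uC_φ : B^α → Z_β` is compact: it is bounded and maps bounded sets of `B^α` to
totally bounded (equivalently, since `Z_β` is complete, relatively compact) subsets
of `Z_β`. -/
def CompactBlochToZygmund (α β : ℝ) (u φ : ℂ → ℂ) : Prop :=
  BoundedBlochToZygmund α β u φ ∧
    ∀ r : ℝ, ∀ ε : ℝ, 0 < ε → ∃ T : Finset (ℂ → ℂ),
      (∀ g ∈ T, MemZygmund β g) ∧
      ∀ f, MemBloch α f → blochNorm α f ≤ r →
        ∃ g ∈ T, zygNorm β (fun z => wcomp u φ f z - g z) ≤ ε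

/-- `uC_φ : B^α → H^∞_{ν_β}` is compact: it is bounded and maps bounded sets of `B^α`
to totally bounded (equivalently, relatively compact) subsets of `H^∞_{ν_β}`. -/
def CompactBlochToWeighted (α β : ℝ) (u φ : ℂ → ℂ) : Prop :=
  BoundedBlochToWeighted α β u φ ∧
    ∀ r : ℝ, ∀ ε : ℝ, 0 < ε → ∃ T : Finset (ℂ → ℂ),
      (∀ g ∈ T, MemWeighted β g) ∧
      ∀ f, MemBloch α f → blochNorm α f ≤ r →
        ∃ g ∈ T, wnorm β (fun z => wcomp u φ f z - g z) ≤ ε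

/-- A compact (linear, bounded, with totally bounded image of the unit ball) operator
from the subspace of `B^α` cut out by the predicate `P` into `Z_β`. -/
def IsCompactOpToZygmund (α β : ℝ) (P : (ℂ → ℂ) → Prop) (K : (ℂ → ℂ) → ℂ → ℂ) : Prop :=
  (∀ f g, P f → P g → ∀ a b : ℂ,
      K (fun z => a * f z + b * g z) = fun z => a * K f z + b * K g z) ∧
  (∀ f, P f → MemZygmund β (K f)) ∧
  (∃ C, ∀ f, P f → zygNorm β (K f) ≤ C * blochNorm α f) ∧
  (∀ ε : ℝ, 0 < ε → ∃ T : Finset (ℂ → ℂ), (∀ g ∈ T, MemZygmund β g) ∧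
      ∀ f, P f → blochNorm α f ≤ 1 → ∃ g ∈ T, zygNorm β (fun z => K f z - g z) ≤ ε)

/-- The essential norm of `uC_φ`, as an operator from the subspace of `B^α` cut out by
the predicate `P` into `Z_β`: the distance to the compact operators, the operator norm
being the supremum over the unit ball. -/
def essNormZ (α β : ℝ) (P : (ℂ → ℂ) → Prop) (u φ : ℂ → ℂ) : ℝ :=
  sInf {r | ∃ K, IsCompactOpToZygmund α β P K ∧
    r = sSup {s | ∃ f, P f ∧ blochNorm α f ≤ 1 ∧
          s = zygNorm β (fun z => wcomp u φ f z - K f z)}}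

/-- A compact (linear, bounded, with totally bounded image of the unit ball) operator
from `B^α` into `H^∞_{ν_β}`. -/
def IsCompactOpToWeighted (α β : ℝ) (K : (ℂ → ℂ) → ℂ → ℂ) : Prop :=
  (∀ f g, MemBloch α f → MemBloch α g → ∀ a b : ℂ,
      K (fun z => a * f z + b * g z) = fun z => a * K f z + b * K g z) ∧
  (∀ f, MemBloch α f → MemWeighted β (K f)) ∧
  (∃ C, ∀ f, MemBloch α f → wnorm β (K f) ≤ C * blochNorm α f) ∧
  (∀ ε : ℝ, 0 < ε → ∃ T : Finset (ℂ → ℂ), (∀ g ∈ T, MemWeighted β g) ∧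
      ∀ f, MemBloch α f → blochNorm α f ≤ 1 → ∃ g ∈ T, wnorm β (fun z => K f z - g z) ≤ ε)

/-- The essential norm of `uC_φ : B^α → H^∞_{ν_β}`. -/
def essNormW (α β : ℝ) (u φ : ℂ → ℂ) : ℝ :=
  sInf {r | ∃ K, IsCompactOpToWeighted α β K ∧
    r = sSup {s | ∃ f, MemBloch α f ∧ blochNorm α f ≤ 1 ∧
          s = wnorm β (fun z => wcomp u φ f z - K f z)}}

/-- `limsup_{|φ(z)|→1} F(z) = lim_{s→1⁻} sup {F z : z ∈ 𝔻, |φ z| > s}`.  Since the inner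
supremum is nonincreasing in `s`, the limit equals the infimum over `s ∈ [0,1)`; note
that `Real.sSup ∅ = 0`, matching the convention that the value is `0` when
`{z : |φ z| > s}` is empty for some `s < 1`. -/
def phiLimsup (φ : ℂ → ℂ) (F : ℂ → ℝ) : ℝ :=
  sInf ((fun s => sSup {y | ∃ z ∈ unitDisk, s < ‖φ z‖ ∧ y = F z}) '' Set.Ico (0:ℝ) 1)

lemma mem_unitDisk {z : ℂ} : z ∈ unitDisk ↔ ‖z‖ < 1 := by simp [unitDisk]

lemma isOpen_unitDisk : IsOpen unitDisk := Metric.isOpen_ball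

lemma one_sub_norm_sq_pos {z : ℂ} (hz : z ∈ unitDisk) : 0 < 1 - ‖z‖ ^ 2 := by
  rw [mem_unitDisk] at hz
  nlinarith [norm_nonneg z]

lemma hasDerivAt_of_differentiableOn_unitDisk {f : ℂ → ℂ} (hf : DifferentiableOn ℂ f unitDisk)
    {z : ℂ} (hz : z ∈ unitDisk) : HasDerivAt f (deriv f z) z :=
  (hf.differentiableAt (isOpen_unitDisk.mem_nhds hz)).hasDerivAt

lemma differentiableOn_deriv_unitDisk {f : ℂ → ℂ} (hf : DifferentiableOn ℂ f unitDisk) :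
    DifferentiableOn ℂ (deriv f) unitDisk :=
  hf.deriv isOpen_unitDisk

lemma differentiableOn_wcomp {u φ f : ℂ → ℂ} (hu : DifferentiableOn ℂ u unitDisk)
    (hφd : DifferentiableOn ℂ φ unitDisk) (hφm : Set.MapsTo φ unitDisk unitDisk)
    (hf : DifferentiableOn ℂ f unitDisk) :
    DifferentiableOn ℂ (wcomp u φ f) unitDisk :=
  hu.mul (hf.comp hφd hφm)

lemma deriv_wcomp {u φ f : ℂ → ℂ} (hu : DifferentiableOn ℂ u unitDisk)
    (hφd : DifferentiableOn ℂ φ unitDisk) (hφm : Set.MapsTo φ unitDisk unitDisk)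
    (hf : DifferentiableOn ℂ f unitDisk)
    {z : ℂ} (hz : z ∈ unitDisk) :
    deriv (wcomp u φ f) z = deriv u z * f (φ z) + u z * (deriv f (φ z) * deriv φ z) :=
  ((hasDerivAt_of_differentiableOn_unitDisk hu hz).mul
    ((hasDerivAt_of_differentiableOn_unitDisk hf (hφm hz)).comp z
      (hasDerivAt_of_differentiableOn_unitDisk hφd hz))).deriv

lemma deriv_deriv_wcomp {u φ f : ℂ → ℂ} (hu : DifferentiableOn ℂ u unitDisk)
    (hφd : DifferentiableOn ℂ φ unitDisk) (hφm : Set.MapsTo φ unitDisk unitDisk)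
    (hf : DifferentiableOn ℂ f unitDisk)
    {z : ℂ} (hz : z ∈ unitDisk) :
    deriv (deriv (wcomp u φ f)) z = deriv (deriv u) z * f (φ z)
      + (2 * deriv u z * deriv φ z + u z * deriv (deriv φ) z) * deriv f (φ z)
      + u z * deriv φ z ^ 2 * deriv (deriv f) (φ z) := by
  have heq : deriv (wcomp u φ f) =ᶠ[nhds z]
      fun z => deriv u z * f (φ z) + u z * (deriv f (φ z) * deriv φ z) := by
    filter_upwards [isOpen_unitDisk.mem_nhds hz] with w hw
    exact deriv_wcomp hu hφd hφm hf hw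
  have dφ := hasDerivAt_of_differentiableOn_unitDisk hφd hz
  have dφ' := hasDerivAt_of_differentiableOn_unitDisk (differentiableOn_deriv_unitDisk hφd) hz
  have du := hasDerivAt_of_differentiableOn_unitDisk hu hz
  have du' := hasDerivAt_of_differentiableOn_unitDisk (differentiableOn_deriv_unitDisk hu) hz
  have df := (hasDerivAt_of_differentiableOn_unitDisk hf (hφm hz)).comp z dφ
  have df' := (hasDerivAt_of_differentiableOn_unitDisk
    (differentiableOn_deriv_unitDisk hf) (hφm hz)).comp z dφ
  have h := (du'.mul df).add (du.mul (df'.mul dφ'))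
  rw [heq.deriv_eq]
  refine h.deriv.trans ?_
  simp only [Function.comp_apply, Pi.mul_apply]
  ring

lemma le_wnorm {γ : ℝ} {g : ℂ → ℂ}
    (hg : BddAbove ((fun z => (1 - ‖z‖ ^ 2) ^ γ * ‖g z‖) '' unitDisk)) {z : ℂ}
    (hz : z ∈ unitDisk) : (1 - ‖z‖ ^ 2) ^ γ * ‖g z‖ ≤ wnorm γ g :=
  le_csSup hg (mem_image_of_mem _ hz)

lemma wnorm_le {γ M : ℝ} {g : ℂ → ℂ}
    (hg : ∀ z ∈ unitDisk, (1 - ‖z‖ ^ 2) ^ γ * ‖g z‖ ≤ M) : wnorm γ g ≤ M := by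
  refine csSup_le ⟨_, mem_image_of_mem _ (mem_unitDisk.2 (by simp) : (0 : ℂ) ∈ unitDisk)⟩ ?_
  rintro _ ⟨z, hz, rfl⟩
  exact hg z hz

lemma one_le_log_exp_div {w : ℂ} (hw : w ∈ unitDisk) :
    1 ≤ Real.log (Real.exp 1 / (1 - ‖w‖ ^ 2)) := by
  have hs := one_sub_norm_sq_pos hw
  rw [Real.log_div (Real.exp_pos 1).ne' hs.ne', Real.log_exp]
  have := Real.log_nonpos hs.le (by nlinarith [norm_nonneg w])
  linarith

lemma MemBloch.norm_deriv_le {f : ℂ → ℂ} (hf : MemBloch 1 f) {w : ℂ} (hw : w ∈ unitDisk) :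
    ‖deriv f w‖ ≤ wnorm 1 (deriv f) / (1 - ‖w‖ ^ 2) := by
  rw [le_div_iff₀ (one_sub_norm_sq_pos hw), mul_comm]
  simpa using le_wnorm hf.2 hw

lemma MemBloch.wnorm_deriv_nonneg {f : ℂ → ℂ} (hf : MemBloch 1 f) : 0 ≤ wnorm 1 (deriv f) := by
  have h := le_wnorm hf.2 (mem_unitDisk.2 (by simp) : (0 : ℂ) ∈ unitDisk)
  simp only [norm_zero] at h
  exact le_trans (by positivity) h

lemma MemBloch.blochNorm_nonneg {f : ℂ → ℂ} (hf : MemBloch 1 f) : 0 ≤ blochNorm 1 f :=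
  add_nonneg (norm_nonneg _) hf.wnorm_deriv_nonneg

lemma MemBloch.norm_deriv_le_blochNorm {f : ℂ → ℂ} (hf : MemBloch 1 f) {w : ℂ} (hw : w ∈ unitDisk) :
    ‖deriv f w‖ ≤ blochNorm 1 f / (1 - ‖w‖ ^ 2) := by
  refine (hf.norm_deriv_le hw).trans ?_
  have := one_sub_norm_sq_pos hw
  gcongr
  exact le_add_of_nonneg_left (norm_nonneg _)

lemma MemBloch.norm_deriv_deriv_le {f : ℂ → ℂ} (hf : MemBloch 1 f) {w : ℂ} (hw : w ∈ unitDisk) :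
    ‖deriv (deriv f) w‖ ≤ 16 * blochNorm 1 f / (1 - ‖w‖ ^ 2) ^ 2 := by
  have hs := one_sub_norm_sq_pos hw
  have hw1 := mem_unitDisk.1 hw
  have hN := hf.blochNorm_nonneg
  have hR : 0 < (1 - ‖w‖) / 2 := by linarith
  have hz : ∀ z ∈ Metric.closedBall w ((1 - ‖w‖) / 2), ‖z‖ ≤ (1 + ‖w‖) / 2 := by
    intro z hz
    rw [mem_closedBall_iff_norm] at hz
    linarith [norm_le_norm_sub_add z w]
  have hsub : Metric.closedBall w ((1 - ‖w‖) / 2) ⊆ unitDisk := fun z h =>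
    mem_unitDisk.2 (by linarith [hz z h])
  have key := norm_deriv_le_of_forall_mem_sphere_norm_le
    (C := blochNorm 1 f / ((1 - ‖w‖) / 2)) (f := deriv f) hR
    (((differentiableOn_deriv_unitDisk hf.1).mono hsub).diffContOnCl_ball subset_rfl)
    (fun z h => by
      have h' := Metric.sphere_subset_closedBall h
      refine (hf.norm_deriv_le_blochNorm (hsub h')).trans ?_
      have := hz z h'
      gcongr
      nlinarith [norm_nonneg z, norm_nonneg w])
  refine key.trans ?_
  rw [div_div, div_le_div_iff₀ (by positivity) (by positivity)]
  have h2 : 1 - ‖w‖ ^ 2 ≤ 2 * (1 - ‖w‖) := by nlinarith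
  have h3 : (1 - ‖w‖ ^ 2) ^ 2 ≤ (2 * (1 - ‖w‖)) ^ 2 := by gcongr
  nlinarith

lemma MemBloch.norm_le {f : ℂ → ℂ} (hf : MemBloch 1 f) {w : ℂ} (hw : w ∈ unitDisk) :
    ‖f w‖ ≤ blochNorm 1 f * Real.log (Real.exp 1 / (1 - ‖w‖ ^ 2)) := by
  have hs := one_sub_norm_sq_pos hw
  have hw1 := mem_unitDisk.1 hw
  have hr := norm_nonneg w
  have hM := hf.wnorm_deriv_nonneg
  set M := wnorm 1 (deriv f) with hMdef
  have hlt : ∀ t ∈ Icc (0 : ℝ) 1, t * ‖w‖ < 1 := fun t ht => by nlinarith [ht.1, ht.2]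
  have hnorm : ∀ t ∈ Icc (0 : ℝ) 1, ‖(t : ℂ) * w‖ = t * ‖w‖ := fun t ht => by
    rw [norm_mul, Complex.norm_real, Real.norm_of_nonneg ht.1]
  have hmem : ∀ t ∈ Icc (0 : ℝ) 1, (t : ℂ) * w ∈ unitDisk := fun t ht =>
    mem_unitDisk.2 (by rw [hnorm t ht]; exact hlt t ht)
  have hd : ∀ t ∈ Icc (0 : ℝ) 1,
      HasDerivAt (fun t : ℝ => f (t * w)) (deriv f (t * w) * w) t := fun t ht => by
    have h1 : HasDerivAt (fun x : ℂ => x * w) w (t : ℂ) := by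
      simpa using (hasDerivAt_id (t : ℂ)).mul_const w
    exact ((hasDerivAt_of_differentiableOn_unitDisk hf.1 (hmem t ht)).comp (t : ℂ) h1).comp_ofReal
  have hB : ∀ t ∈ Icc (0 : ℝ) 1,
      HasDerivAt (fun t : ℝ => ‖f 0‖ + M * -Real.log (1 - t * ‖w‖))
        (M * (‖w‖ / (1 - t * ‖w‖))) t := fun t ht => by
    have h1 : HasDerivAt (fun x : ℝ => 1 - x * ‖w‖) (-‖w‖) t := by
      simpa using ((hasDerivAt_id t).mul_const ‖w‖).const_sub 1
    have h2 := ((h1.log (by linarith [hlt t ht])).neg.const_mul M).const_add ‖f 0‖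
    exact h2.congr_deriv (by ring)
  have key := image_norm_le_of_norm_deriv_right_le_deriv_boundary'
    (f := fun t : ℝ => f (t * w)) (a := 0) (b := 1)
    (fun t ht => (hd t ht).continuousAt.continuousWithinAt)
    (fun t ht => (hd t (Ico_subset_Icc_self ht)).hasDerivWithinAt)
    (by simp)
    (fun t ht => (hB t ht).continuousAt.continuousWithinAt)
    (fun t ht => (hB t (Ico_subset_Icc_self ht)).hasDerivWithinAt)
    (fun t ht => by
      have ht' := Ico_subset_Icc_self ht
      have h1 := hf.norm_deriv_le (hmem t ht')
      rw [hnorm t ht'] at h1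
      have h2 := hlt t ht'
      have h3 : 0 ≤ t * ‖w‖ := mul_nonneg ht'.1 hr
      have h4 : M / (1 - (t * ‖w‖) ^ 2) ≤ M / (1 - t * ‖w‖) := by
        gcongr
        nlinarith
      rw [norm_mul, mul_div_assoc', mul_div_right_comm]
      gcongr
      exact h1.trans h4)
    (right_mem_Icc.2 zero_le_one)
  simp only [Complex.ofReal_one, one_mul] at key
  have hL := one_le_log_exp_div hw
  have hlog : -Real.log (1 - ‖w‖) ≤ Real.log (Real.exp 1 / (1 - ‖w‖ ^ 2)) := by
    rw [← Real.log_inv]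
    refine Real.log_le_log (by rw [inv_pos]; linarith) ?_
    rw [inv_eq_one_div, div_le_div_iff₀ (by linarith) hs]
    nlinarith [Real.add_one_le_exp 1]
  calc ‖f w‖ ≤ ‖f 0‖ + M * -Real.log (1 - ‖w‖) := key
    _ ≤ ‖f 0‖ * Real.log (Real.exp 1 / (1 - ‖w‖ ^ 2))
        + M * Real.log (Real.exp 1 / (1 - ‖w‖ ^ 2)) := by
      gcongr
      exact le_mul_of_one_le_right (norm_nonneg _) hL
    _ = _ := by rw [blochNorm, add_mul]

lemma norm_one_sub_conj_mul_pos {a w : ℂ} (ha : a ∈ unitDisk) (hw : w ∈ unitDisk) :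
    0 < ‖1 - (starRingEnd ℂ) a * w‖ := by
  rw [mem_unitDisk] at ha hw
  have h := norm_sub_norm_le 1 ((starRingEnd ℂ) a * w)
  rw [norm_mul, RCLike.norm_conj, norm_one] at h
  nlinarith [norm_nonneg a, norm_nonneg w]

lemma one_sub_conj_mul_ne_zero {a w : ℂ} (ha : a ∈ unitDisk) (hw : w ∈ unitDisk) :
    1 - (starRingEnd ℂ) a * w ≠ 0 :=
  norm_pos_iff.1 (norm_one_sub_conj_mul_pos ha hw)

lemma norm_sq_one_sub_conj_mul (a w : ℂ) :
    ‖1 - (starRingEnd ℂ) a * w‖ ^ 2 = ‖a - w‖ ^ 2 + (1 - ‖a‖ ^ 2) * (1 - ‖w‖ ^ 2) := by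
  simp only [← Complex.normSq_eq_norm_sq, Complex.normSq_apply]
  simp
  ring

lemma one_sub_conj_mul_self (a : ℂ) :
    1 - (starRingEnd ℂ) a * a = ((1 - ‖a‖ ^ 2 : ℝ) : ℂ) := by
  rw [Complex.conj_mul']
  push_cast
  rfl

lemma hasDerivAt_one_sub_conj_mul (a w : ℂ) :
    HasDerivAt (fun w => 1 - (starRingEnd ℂ) a * w) (-(starRingEnd ℂ) a) w := by
  simpa using ((hasDerivAt_id w).const_mul ((starRingEnd ℂ) a)).const_sub 1

/-- The disk automorphism exchanging `0` and `a`. -/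
def diskAut (a w : ℂ) : ℂ := (a - w) / (1 - (starRingEnd ℂ) a * w)

/-- The derivative of `diskAut a`. -/
def diskAutDeriv (a w : ℂ) : ℂ :=
  -((1 - ‖a‖ ^ 2 : ℝ) : ℂ) / (1 - (starRingEnd ℂ) a * w) ^ 2

lemma hasDerivAt_diskAut {a w : ℂ} (ha : a ∈ unitDisk) (hw : w ∈ unitDisk) :
    HasDerivAt (diskAut a) (diskAutDeriv a w) w := by
  have h := ((hasDerivAt_id w).const_sub a).div (hasDerivAt_one_sub_conj_mul a w)
    (one_sub_conj_mul_ne_zero ha hw)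
  refine h.congr_deriv ?_
  rw [diskAutDeriv, ← one_sub_conj_mul_self]
  simp only [id]
  congr 1
  ring

lemma hasDerivAt_diskAutDeriv {a : ℂ} (ha : a ∈ unitDisk) :
    HasDerivAt (diskAutDeriv a)
      (-(2 * (starRingEnd ℂ) a) / ((1 - ‖a‖ ^ 2 : ℝ) : ℂ) ^ 2) a := by
  have h0 := one_sub_conj_mul_ne_zero ha ha
  have h := (hasDerivAt_const a (-((1 - ‖a‖ ^ 2 : ℝ) : ℂ))).div
    ((hasDerivAt_one_sub_conj_mul a a).pow 2) (pow_ne_zero 2 h0)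
  refine h.congr_deriv ?_
  simp only [Pi.pow_apply]
  rw [← one_sub_conj_mul_self]
  field_simp
  ring

lemma diskAut_self (a : ℂ) : diskAut a a = 0 := by simp [diskAut]

lemma diskAutDeriv_self {a : ℂ} (ha : a ∈ unitDisk) :
    diskAutDeriv a a = -1 / ((1 - ‖a‖ ^ 2 : ℝ) : ℂ) := by
  have h0 := one_sub_conj_mul_ne_zero ha ha
  rw [diskAutDeriv, ← one_sub_conj_mul_self]
  field_simp

lemma norm_diskAut_le {a w : ℂ} (ha : a ∈ unitDisk) (hw : w ∈ unitDisk) :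
    ‖diskAut a w‖ ≤ 1 := by
  rw [diskAut, norm_div, div_le_one (norm_one_sub_conj_mul_pos ha hw)]
  refine (sq_le_sq₀ (norm_nonneg _) (norm_nonneg _)).1 ?_
  rw [norm_sq_one_sub_conj_mul]
  have := mul_pos (one_sub_norm_sq_pos ha) (one_sub_norm_sq_pos hw)
  linarith

lemma mul_norm_diskAutDeriv_le {a w : ℂ} (ha : a ∈ unitDisk) (hw : w ∈ unitDisk) :
    (1 - ‖w‖ ^ 2) * ‖diskAutDeriv a w‖ ≤ 1 := by
  have h := norm_one_sub_conj_mul_pos ha hw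
  rw [diskAutDeriv, norm_div, norm_neg, Complex.norm_real,
    Real.norm_of_nonneg (one_sub_norm_sq_pos ha).le, norm_pow, mul_div_assoc',
    div_le_one (by positivity), norm_sq_one_sub_conj_mul]
  nlinarith [sq_nonneg ‖a - w‖]

/-- Testing a bounded operator `uC_φ` on a Bloch function with prescribed derivatives. -/
lemma BoundedBlochToZygmund.exists_test_bound {β : ℝ} {u φ : ℂ → ℂ}
    (h : BoundedBlochToZygmund 1 β u φ) (hu : DifferentiableOn ℂ u unitDisk)
    (hφd : DifferentiableOn ℂ φ unitDisk) (hφm : Set.MapsTo φ unitDisk unitDisk) :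
    ∃ C, ∀ (f f₁ : ℂ → ℂ) (f₂ z : ℂ), z ∈ unitDisk →
      (∀ w ∈ unitDisk, HasDerivAt f (f₁ w) w) → HasDerivAt f₁ f₂ (φ z) → ‖f 0‖ ≤ 1 →
      (∀ w ∈ unitDisk, (1 - ‖w‖ ^ 2) * ‖f₁ w‖ ≤ 2) →
      (1 - ‖z‖ ^ 2) ^ β * ‖deriv (deriv u) z * f (φ z)
        + (2 * deriv u z * deriv φ z + u z * deriv (deriv φ) z) * f₁ (φ z)
        + u z * deriv φ z ^ 2 * f₂‖ ≤ C := by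
  obtain ⟨hmap, C, hC, hbd⟩ := h
  refine ⟨C * 3, fun f f₁ f₂ z hz hf hf₁ h0 hb => ?_⟩
  have hfd : DifferentiableOn ℂ f unitDisk := fun w hw =>
    (hf w hw).differentiableAt.differentiableWithinAt
  have hder : ∀ w ∈ unitDisk, (1 - ‖w‖ ^ 2) ^ (1 : ℝ) * ‖deriv f w‖ ≤ 2 := fun w hw => by
    rw [Real.rpow_one, (hf w hw).deriv]
    exact hb w hw
  have hmem : MemBloch 1 f := by
    refine ⟨hfd, 2, ?_⟩
    rintro _ ⟨w, hw, rfl⟩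
    exact hder w hw
  have hN : blochNorm 1 f ≤ 3 := by
    have := wnorm_le hder
    rw [blochNorm]
    linarith
  have heq : deriv f =ᶠ[nhds (φ z)] f₁ := by
    filter_upwards [isOpen_unitDisk.mem_nhds (hφm hz)] with w hw
    exact (hf w hw).deriv
  have h2 : deriv (deriv f) (φ z) = f₂ := by rw [heq.deriv_eq, hf₁.deriv]
  have hle := le_wnorm (hmap f hmem).2 hz
  rw [deriv_deriv_wcomp hu hφd hφm hfd hz, h2, (hf _ (hφm hz)).deriv] at hle
  refine hle.trans ?_
  calc wnorm β (deriv (deriv (wcomp u φ f))) ≤ zygNorm β (wcomp u φ f) :=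
        le_add_of_nonneg_left (by positivity)
    _ ≤ C * blochNorm 1 f := hbd f hmem
    _ ≤ C * 3 := by gcongr

lemma BoundedBlochToZygmund.exists_bound_mul_deriv_sq {β : ℝ} {u φ : ℂ → ℂ}
    (h : BoundedBlochToZygmund 1 β u φ) (hu : DifferentiableOn ℂ u unitDisk)
    (hφd : DifferentiableOn ℂ φ unitDisk) (hφm : Set.MapsTo φ unitDisk unitDisk) :
    ∃ C : ℝ, ∀ z ∈ unitDisk,
      (1 - ‖z‖ ^ 2) ^ β * (‖u z‖ * ‖deriv φ z‖ ^ 2) / (1 - ‖φ z‖ ^ 2) ^ 2 ≤ C := by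
  obtain ⟨C, hC⟩ := h.exists_test_bound hu hφd hφm
  refine ⟨C / 2, fun z hz => ?_⟩
  have ha := hφm hz
  have hs := one_sub_norm_sq_pos ha
  have hsC : ((1 - ‖φ z‖ ^ 2 : ℝ) : ℂ) ≠ 0 := by exact_mod_cast hs.ne'
  have ht := hC (fun w => diskAut (φ z) w ^ 2)
    (fun w => 2 * (diskAut (φ z) w * diskAutDeriv (φ z) w))
    (2 / ((1 - ‖φ z‖ ^ 2 : ℝ) : ℂ) ^ 2) z hz
    (fun w hw => ((hasDerivAt_diskAut ha hw).pow 2).congr_deriv (by simp; ring))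
    ((((hasDerivAt_diskAut ha ha).mul (hasDerivAt_diskAutDeriv ha)).const_mul 2).congr_deriv
      (by
        rw [diskAut_self, diskAutDeriv_self ha]
        field_simp
        ring))
    (by
      rw [norm_pow]
      exact pow_le_one₀ (norm_nonneg _) (norm_diskAut_le ha (mem_unitDisk.2 (by simp))))
    (fun w hw => by
      have h1 := norm_diskAut_le ha hw
      have h2 := mul_norm_diskAutDeriv_le ha hw
      have h3 := one_sub_norm_sq_pos hw
      rw [norm_mul, norm_mul, Complex.norm_two]
      nlinarith [norm_nonneg (diskAut (φ z) w),
        mul_nonneg h3.le (norm_nonneg (diskAutDeriv (φ z) w))])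
  simp only [diskAut_self, ne_eq, OfNat.ofNat_ne_zero, not_false_eq_true, zero_pow, mul_zero,
    zero_mul, zero_add, norm_mul, norm_div, norm_pow, Complex.norm_two, Complex.norm_real,
    Real.norm_of_nonneg hs.le] at ht
  rw [le_div_iff₀ two_pos]
  refine le_of_eq_of_le ?_ ht
  ring

lemma BoundedBlochToZygmund.exists_bound_mixed {β : ℝ} {u φ : ℂ → ℂ}
    (h : BoundedBlochToZygmund 1 β u φ) (hu : DifferentiableOn ℂ u unitDisk)
    (hφd : DifferentiableOn ℂ φ unitDisk) (hφm : Set.MapsTo φ unitDisk unitDisk) :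
    ∃ C : ℝ, ∀ z ∈ unitDisk,
      (1 - ‖z‖ ^ 2) ^ β * ‖2 * deriv u z * deriv φ z + u z * deriv (deriv φ) z‖
        / (1 - ‖φ z‖ ^ 2) ≤ C := by
  obtain ⟨C₂, hC₂⟩ := h.exists_bound_mul_deriv_sq hu hφd hφm
  obtain ⟨C, hC⟩ := h.exists_test_bound hu hφd hφm
  refine ⟨C + 2 * C₂, fun z hz => ?_⟩
  have ha := hφm hz
  have hs := one_sub_norm_sq_pos ha
  have hW : 0 ≤ (1 - ‖z‖ ^ 2) ^ β := Real.rpow_nonneg (one_sub_norm_sq_pos hz).le _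
  have ht := hC (diskAut (φ z)) (diskAutDeriv (φ z)) _ z hz (fun w hw => hasDerivAt_diskAut ha hw)
    (hasDerivAt_diskAutDeriv ha) (norm_diskAut_le ha (mem_unitDisk.2 (by simp)))
    (fun w hw => (mul_norm_diskAutDeriv_le ha hw).trans one_le_two)
  rw [diskAut_self, diskAutDeriv_self ha, mul_zero, zero_add] at ht
  have h2 := hC₂ z hz
  set D₁ := 2 * deriv u z * deriv φ z + u z * deriv (deriv φ) z
  set s := 1 - ‖φ z‖ ^ 2
  have hX : ‖D₁ * (-1 / (s : ℂ))‖ = ‖D₁‖ / s := by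
    simp [abs_of_pos hs, div_eq_mul_inv]
  have hY : ‖u z * deriv φ z ^ 2 * (-(2 * (starRingEnd ℂ) (φ z)) / (s : ℂ) ^ 2)‖
      ≤ 2 * (‖u z‖ * ‖deriv φ z‖ ^ 2 / s ^ 2) := by
    simp only [norm_mul, norm_div, norm_neg, norm_pow, Complex.norm_real, Complex.norm_two,
      Real.norm_of_nonneg hs.le, RCLike.norm_conj]
    have : ‖u z‖ * ‖deriv φ z‖ ^ 2 * (2 * ‖φ z‖ / s ^ 2)
        = 2 * (‖u z‖ * ‖deriv φ z‖ ^ 2 / s ^ 2) * ‖φ z‖ := by ring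
    rw [this]
    exact mul_le_of_le_one_right (by positivity) (mem_unitDisk.1 ha).le
  have htri := norm_le_add_norm_add (D₁ * (-1 / (s : ℂ)))
    (u z * deriv φ z ^ 2 * (-(2 * (starRingEnd ℂ) (φ z)) / (s : ℂ) ^ 2))
  rw [hX] at htri
  have := mul_le_mul_of_nonneg_left (htri.trans (add_le_add_right hY _)) hW
  rw [mul_div_assoc] at h2 ⊢
  linarith

lemma BoundedBlochToZygmund.exists_bound_log {β : ℝ} {u φ : ℂ → ℂ}
    (h : BoundedBlochToZygmund 1 β u φ) (hu : DifferentiableOn ℂ u unitDisk)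
    (hφd : DifferentiableOn ℂ φ unitDisk) (hφm : Set.MapsTo φ unitDisk unitDisk) :
    ∃ C : ℝ, ∀ z ∈ unitDisk,
      (1 - ‖z‖ ^ 2) ^ β * ‖deriv (deriv u) z‖
        * Real.log (Real.exp 1 / (1 - ‖φ z‖ ^ 2)) ≤ C := by
  obtain ⟨C₁, hC₁⟩ := h.exists_bound_mixed hu hφd hφm
  obtain ⟨C₂, hC₂⟩ := h.exists_bound_mul_deriv_sq hu hφd hφm
  obtain ⟨C, hC⟩ := h.exists_test_bound hu hφd hφm
  refine ⟨C + C₁ + C₂, fun z hz => ?_⟩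
  have ha := hφm hz
  have hs := one_sub_norm_sq_pos ha
  have ha1 := (mem_unitDisk.1 ha).le
  have hW : 0 ≤ (1 - ‖z‖ ^ 2) ^ β := Real.rpow_nonneg (one_sub_norm_sq_pos hz).le _
  have ht := hC (fun w => 1 - Complex.log (1 - (starRingEnd ℂ) (φ z) * w))
    (fun w => (starRingEnd ℂ) (φ z) / (1 - (starRingEnd ℂ) (φ z) * w))
    ((starRingEnd ℂ) (φ z) ^ 2 / ((1 - ‖φ z‖ ^ 2 : ℝ) : ℂ) ^ 2) z hz
    (fun w hw => by
      have hlt : ‖(starRingEnd ℂ) (φ z) * w‖ < 1 := by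
        rw [norm_mul, RCLike.norm_conj]
        nlinarith [mem_unitDisk.1 hw, mem_unitDisk.1 ha, norm_nonneg w, norm_nonneg (φ z)]
      have hslit : 1 - (starRingEnd ℂ) (φ z) * w ∈ Complex.slitPlane := by
        rw [sub_eq_add_neg]
        exact Complex.mem_slitPlane_of_norm_lt_one (by rwa [norm_neg])
      refine (((hasDerivAt_one_sub_conj_mul (φ z) w).clog hslit).const_sub 1).congr_deriv ?_
      ring)
    (((hasDerivAt_const (φ z) ((starRingEnd ℂ) (φ z))).div (hasDerivAt_one_sub_conj_mul _ _)
      (one_sub_conj_mul_ne_zero ha ha)).congr_deriv (by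
        rw [one_sub_conj_mul_self]
        ring))
    (by simp)
    (fun w hw => by
      have hpos := norm_one_sub_conj_mul_pos ha hw
      have hw1 := mem_unitDisk.1 hw
      have hsub := norm_sub_norm_le 1 ((starRingEnd ℂ) (φ z) * w)
      rw [norm_mul, RCLike.norm_conj, norm_one] at hsub
      rw [norm_div, mul_div_assoc', div_le_iff₀ hpos, RCLike.norm_conj]
      nlinarith [norm_nonneg w, norm_nonneg (φ z), one_sub_norm_sq_pos hw])
  have hlog : (1 : ℂ) - Complex.log (1 - (starRingEnd ℂ) (φ z) * φ z)
      = ((Real.log (Real.exp 1 / (1 - ‖φ z‖ ^ 2)) : ℝ) : ℂ) := by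
    rw [one_sub_conj_mul_self, Real.log_div (Real.exp_pos 1).ne' hs.ne', Real.log_exp,
      ← Complex.ofReal_log hs.le]
    push_cast
    rfl
  rw [hlog, one_sub_conj_mul_self] at ht
  have h1 := hC₁ z hz
  have h2 := hC₂ z hz
  have hL := one_le_log_exp_div ha
  set D₀ := deriv (deriv u) z
  set D₁ := 2 * deriv u z * deriv φ z + u z * deriv (deriv φ) z
  set L := Real.log (Real.exp 1 / (1 - ‖φ z‖ ^ 2))
  set s := 1 - ‖φ z‖ ^ 2
  set X := D₀ * (L : ℂ) with hXdef
  set Y := D₁ * ((starRingEnd ℂ) (φ z) / (s : ℂ)) with hYdef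
  set Z := u z * deriv φ z ^ 2 * ((starRingEnd ℂ) (φ z) ^ 2 / (s : ℂ) ^ 2) with hZdef
  have hX : ‖X‖ = ‖D₀‖ * L := by
    rw [hXdef, norm_mul, Complex.norm_real, Real.norm_of_nonneg (by linarith)]
  have hY : ‖Y‖ ≤ ‖D₁‖ / s := by
    rw [hYdef, norm_mul, norm_div, RCLike.norm_conj, Complex.norm_real, Real.norm_of_nonneg hs.le,
      mul_div_assoc']
    gcongr
    exact mul_le_of_le_one_right (norm_nonneg _) ha1
  have hZ : ‖Z‖ ≤ ‖u z‖ * ‖deriv φ z‖ ^ 2 / s ^ 2 := by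
    simp only [hZdef, norm_mul, norm_div, RCLike.norm_conj, Complex.norm_real, norm_pow,
      Real.norm_of_nonneg hs.le]
    rw [mul_div_assoc', mul_div_right_comm]
    exact mul_le_of_le_one_right (by positivity) (pow_le_one₀ (norm_nonneg _) ha1)
  have htri : ‖X‖ ≤ ‖X + Y + Z‖ + ‖Y‖ + ‖Z‖ := by
    linarith [norm_le_add_norm_add (X + Y) Z, norm_le_add_norm_add X Y]
  rw [hX] at htri
  have := mul_le_mul_of_nonneg_left
    (htri.trans (add_le_add (add_le_add le_rfl hY) hZ)) hW
  rw [mul_div_assoc] at h1 h2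
  rw [mul_assoc]
  linarith

lemma boundedBlochToZygmund_of_bounds {β C₁ C₂ C₃ : ℝ} {u φ : ℂ → ℂ}
    (hu : DifferentiableOn ℂ u unitDisk) (hφd : DifferentiableOn ℂ φ unitDisk)
    (hφm : Set.MapsTo φ unitDisk unitDisk)
    (h₁ : ∀ z ∈ unitDisk, (1 - ‖z‖ ^ 2) ^ β *
      ‖2 * deriv u z * deriv φ z + u z * deriv (deriv φ) z‖ / (1 - ‖φ z‖ ^ 2) ≤ C₁)
    (h₂ : ∀ z ∈ unitDisk,
      (1 - ‖z‖ ^ 2) ^ β * (‖u z‖ * ‖deriv φ z‖ ^ 2) / (1 - ‖φ z‖ ^ 2) ^ 2 ≤ C₂)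
    (h₃ : ∀ z ∈ unitDisk, (1 - ‖z‖ ^ 2) ^ β * ‖deriv (deriv u) z‖ *
      Real.log (Real.exp 1 / (1 - ‖φ z‖ ^ 2)) ≤ C₃) :
    BoundedBlochToZygmund 1 β u φ := by
  have key : ∀ f, MemBloch 1 f → ∀ z ∈ unitDisk,
      (1 - ‖z‖ ^ 2) ^ β * ‖deriv (deriv (wcomp u φ f)) z‖
        ≤ (C₃ + C₁ + 16 * C₂) * blochNorm 1 f := by
    intro f hf z hz
    have ha := hφm hz
    have hW : 0 ≤ (1 - ‖z‖ ^ 2) ^ β := Real.rpow_nonneg (one_sub_norm_sq_pos hz).le _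
    have hN := hf.blochNorm_nonneg
    rw [deriv_deriv_wcomp hu hφd hφm hf.1 hz]
    calc _ ≤ (1 - ‖z‖ ^ 2) ^ β * (‖deriv (deriv u) z‖ *
            (blochNorm 1 f * Real.log (Real.exp 1 / (1 - ‖φ z‖ ^ 2)))
          + ‖2 * deriv u z * deriv φ z + u z * deriv (deriv φ) z‖ *
            (blochNorm 1 f / (1 - ‖φ z‖ ^ 2))
          + ‖u z‖ * ‖deriv φ z‖ ^ 2 * (16 * blochNorm 1 f / (1 - ‖φ z‖ ^ 2) ^ 2)) := by
          gcongr
          refine norm_add₃_le.trans ?_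
          simp only [norm_mul (deriv (deriv u) z), norm_mul (_ + _), norm_mul (u z * _),
            norm_mul (u z) (deriv φ z ^ 2), norm_pow]
          gcongr
          · exact hf.norm_le ha
          · exact hf.norm_deriv_le_blochNorm ha
          · exact hf.norm_deriv_deriv_le ha
      _ = ((1 - ‖z‖ ^ 2) ^ β * ‖deriv (deriv u) z‖ *
              Real.log (Real.exp 1 / (1 - ‖φ z‖ ^ 2))
            + (1 - ‖z‖ ^ 2) ^ β * ‖2 * deriv u z * deriv φ z + u z * deriv (deriv φ) z‖
              / (1 - ‖φ z‖ ^ 2)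
            + 16 * ((1 - ‖z‖ ^ 2) ^ β * (‖u z‖ * ‖deriv φ z‖ ^ 2)
              / (1 - ‖φ z‖ ^ 2) ^ 2)) * blochNorm 1 f := by ring
      _ ≤ _ := by
          gcongr
          · exact h₃ z hz
          · exact h₁ z hz
          · exact h₂ z hz
  have h0 : (0 : ℂ) ∈ unitDisk := mem_unitDisk.2 (by simp)
  have ha := hφm h0
  have hs := one_sub_norm_sq_pos ha
  set L := Real.log (Real.exp 1 / (1 - ‖φ 0‖ ^ 2))
  refine ⟨fun f hf => ⟨differentiableOn_wcomp hu hφd hφm hf.1,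
      (C₃ + C₁ + 16 * C₂) * blochNorm 1 f, ?_⟩,
    max 1 (‖u 0‖ * L + (‖deriv u 0‖ * L + ‖u 0‖ * (1 / (1 - ‖φ 0‖ ^ 2) * ‖deriv φ 0‖))
      + (C₃ + C₁ + 16 * C₂)), by positivity, fun f hf => ?_⟩
  · rintro _ ⟨z, hz, rfl⟩
    exact key f hf z hz
  · have hN := hf.blochNorm_nonneg
    refine le_trans ?_ (mul_le_mul_of_nonneg_right (le_max_right _ _) hN)
    have hf0 : ‖f (φ 0)‖ ≤ blochNorm 1 f * L := hf.norm_le ha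
    have hv : ‖wcomp u φ f 0‖ ≤ ‖u 0‖ * (blochNorm 1 f * L) := by
      rw [wcomp, norm_mul]
      gcongr
    have hd : ‖deriv (wcomp u φ f) 0‖ ≤ ‖deriv u 0‖ * (blochNorm 1 f * L)
        + ‖u 0‖ * (blochNorm 1 f / (1 - ‖φ 0‖ ^ 2) * ‖deriv φ 0‖) := by
      rw [deriv_wcomp hu hφd hφm hf.1 h0]
      refine (norm_add_le _ _).trans ?_
      simp only [norm_mul]
      gcongr
      exact hf.norm_deriv_le_blochNorm ha
    calc zygNorm β (wcomp u φ f) ≤ _ := add_le_add (add_le_add hv hd) (wnorm_le (key f hf))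
      _ = _ := by ring

/-- **Theorem 3.2** (pointwise form). `uC_φ : B → Z_β` is bounded iff the three pointwise
weighted suprema (the last with a logarithmic factor) are finite. -/
theorem weighted_comp_bounded_Bloch_to_Zygmund_iff_of_eq_one'
    (β : ℝ) (hβ : 0 < β)
    (u φ : ℂ → ℂ) (hu : DifferentiableOn ℂ u unitDisk)
    (hφd : DifferentiableOn ℂ φ unitDisk) (hφm : Set.MapsTo φ unitDisk unitDisk) :
    BoundedBlochToZygmund 1 β u φ ↔
      (∃ C : ℝ, ∀ z ∈ unitDisk,
        (1 - ‖z‖ ^ 2) ^ β * ‖2 * deriv u z * deriv φ z + u z * deriv (deriv φ) z‖ / (1 - ‖φ z‖ ^ 2) ≤ C) ∧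
      (∃ C : ℝ, ∀ z ∈ unitDisk,
        (1 - ‖z‖ ^ 2) ^ β * (‖u z‖ * ‖deriv φ z‖ ^ 2) / (1 - ‖φ z‖ ^ 2) ^ 2 ≤ C) ∧
      (∃ C : ℝ, ∀ z ∈ unitDisk,
        (1 - ‖z‖ ^ 2) ^ β * ‖deriv (deriv u) z‖ * Real.log (Real.exp 1 / (1 - ‖φ z‖ ^ 2)) ≤ C) := by
  constructor
  · intro h
    exact ⟨h.exists_bound_mixed hu hφd hφm, h.exists_bound_mul_deriv_sq hu hφd hφm,
      h.exists_bound_log hu hφd hφm⟩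
  · rintro ⟨⟨C₁, h₁⟩, ⟨C₂, h₂⟩, ⟨C₃, h₃⟩⟩
    exact boundedBlochToZygmund_of_bounds hu hφd hφm h₁ h₂ h₃

end
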